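/- For 0 < ε < 1/2, the pentagon P_ε = conv{(0,0), (1−ε,0), (1−ε,ε), (ε,1−ε), (0,1−ε)} is a Delzant polygon whose vertex set is exactly these five points, and its five edges, taken in cyclic order [(0,0),(1−ε,0)], [(1−ε,0),(1−ε,ε)], [(1−ε,ε),(ε,1−ε)], [(ε,1−ε),(0,1−ε)], [(0,1−ε),(0,0)], have rational lengths 1−ε, ε, 1−2ε, ε, 1−ε respectively. -/

import Mathlib

open MeasureTheory

noncomputable section

/-- The real vector in `ℝ²` corresponding to an integer vector in `ℤ²`. -/
def intVec (u : ℤ × ℤ) : ℝ × ℝ := ((u.1 : ℝ), (u.2 : ℝ))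

/-- `RatLenIs w ℓ` : the vector `w` lies on a line of rational slope and has rational
length `ℓ`, i.e. `ℓ > 0` and `w / ℓ` is a primitive vector of `ℤ²` (coprime coordinates). -/
def RatLenIs (w : ℝ × ℝ) (ℓ : ℝ) : Prop :=
  0 < ℓ ∧ ∃ u : ℤ × ℤ, IsCoprime u.1 u.2 ∧ w = ℓ • intVec u

/-- The closed segment `[a, b]`, with `a ≠ b`, is an edge (a one-dimensional face,
i.e. an extreme subset which is a nondegenerate segment) of the convex set `P`. -/
def IsEdge (P : Set (ℝ × ℝ)) (a b : ℝ × ℝ) : Prop :=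
  a ≠ b ∧ IsExtreme ℝ P (segment ℝ a b)

/-- `u ∈ ℤ²` is a direction of an edge of `P` emanating from the vertex `v`. -/
def EdgeDir (P : Set (ℝ × ℝ)) (v : ℝ × ℝ) (u : ℤ × ℤ) : Prop :=
  ∃ w, IsEdge P v w ∧ ∃ ℓ : ℝ, 0 < ℓ ∧ w - v = ℓ • intVec u

/-- The Delzant condition at the vertex `v` of `P`, witnessed by `u₁, u₂` : these are the
primitive integer vectors pointing from `v` along the two edges of `P` incident to `v`,
and they form a `ℤ`-basis of `ℤ²` (their determinant is `±1`). -/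
def DelzantAt (P : Set (ℝ × ℝ)) (v : ℝ × ℝ) (u₁ u₂ : ℤ × ℤ) : Prop :=
  IsCoprime u₁.1 u₁.2 ∧ IsCoprime u₂.1 u₂.2 ∧
  EdgeDir P v u₁ ∧ EdgeDir P v u₂ ∧
  (u₁.1 * u₂.2 - u₁.2 * u₂.1 = 1 ∨ u₁.1 * u₂.2 - u₁.2 * u₂.1 = -1) ∧
  ∀ u : ℤ × ℤ, IsCoprime u.1 u.2 → EdgeDir P v u → u = u₁ ∨ u = u₂

/-- `V` is the (finite) vertex set of a Delzant polygon `P = conv V ⊆ ℝ²`: `P` is a compact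
convex polygon with nonempty interior, its set of vertices (extreme points) is exactly `V`,
and at each vertex the primitive directions of the two incident edges form a `ℤ`-basis of
`ℤ²`; in particular every edge has rational slope. -/
def IsDelzantPolygon (V : Set (ℝ × ℝ)) : Prop :=
  V.Finite ∧ (interior (convexHull ℝ V)).Nonempty ∧
  Set.extremePoints ℝ (convexHull ℝ V) = V ∧
  ∀ v ∈ V, ∃ u₁ u₂ : ℤ × ℤ, DelzantAt (convexHull ℝ V) v u₁ u₂

/-- The new vertex set `(V ∖ {v}) ∪ {v + ε·u₁, v + ε·u₂}` of the `ε`-corner chop at `v`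
of the polygon with vertex set `V`. -/
def chopSet (V : Set (ℝ × ℝ)) (v : ℝ × ℝ) (u₁ u₂ : ℤ × ℤ) (ε : ℝ) : Set (ℝ × ℝ) :=
  (V \ {v}) ∪ {v + ε • intVec u₁, v + ε • intVec u₂}

/-- The polygon with vertex set `W` is an `ε`-corner chop of the Delzant polygon with
vertex set `V` at some vertex `v` whose two incident edges both have rational length
strictly greater than `ε`. -/
def IsCornerChop (V W : Set (ℝ × ℝ)) (ε : ℝ) : Prop :=
  0 < ε ∧ ∃ v ∈ V, ∃ u₁ u₂ : ℤ × ℤ,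
    DelzantAt (convexHull ℝ V) v u₁ u₂ ∧
    (∀ w ℓ, IsEdge (convexHull ℝ V) v w → RatLenIs (w - v) ℓ → ε < ℓ) ∧
    convexHull ℝ W = convexHull ℝ (chopSet V v u₁ u₂ ε)

/-- The vertex set of the standard triangle `Δ = conv {(0,0), (1,0), (0,1)}`. -/
def stdTri : Set (ℝ × ℝ) := {(0, 0), (1, 0), (0, 1)}

/-- A segment of a convex set `P` on which a linear functional attains its maximum over `P`,
and which contains all maximisers, is an edge of `P`. -/
theorem isEdge_of_support {P : Set (ℝ × ℝ)} (hP : Convex ℝ P) {a b : ℝ × ℝ} (hab : a ≠ b)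
    (ha : a ∈ P) (hb : b ∈ P) (α β c : ℝ) (hac : α * a.1 + β * a.2 = c)
    (hbc : α * b.1 + β * b.2 = c) (hle : ∀ p ∈ P, α * p.1 + β * p.2 ≤ c)
    (hface : ∀ p ∈ P, α * p.1 + β * p.2 = c → p ∈ segment ℝ a b) : IsEdge P a b := by
  refine ⟨hab, hP.segment_subset ha hb, ?_⟩
  rintro x hx y hy z ⟨r', s', hr', hs', hrs', rfl⟩ ⟨r, s, hr, hs, hrs, hz⟩
  refine hface x hx (le_antisymm (hle x hx) ?_)
  have e₁ := congrArg Prod.fst hz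
  have e₂ := congrArg Prod.snd hz
  simp only [Prod.fst_add, Prod.smul_fst, Prod.snd_add, Prod.smul_snd, smul_eq_mul] at e₁ e₂
  set A := α * x.1 + β * x.2 with hA
  set B := α * y.1 + β * y.2 with hB
  have key : r * A + s * B = c := by
    linear_combination α * e₁ + β * e₂ + r' * hac + s' * hbc + c * hrs'
  have hyB : B ≤ c := hle y hy
  by_contra! h
  have h₁ : r * A < r * c := mul_lt_mul_of_pos_left h hr
  have h₂ : s * B ≤ s * c := mul_le_mul_of_nonneg_left hyB hs.le
  have h₃ : r * c + s * c = c := by rw [← add_mul, hrs, one_mul]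
  linarith

theorem IsEdge.symm {P : Set (ℝ × ℝ)} {a b : ℝ × ℝ} (h : IsEdge P a b) : IsEdge P b a :=
  ⟨h.1.symm, segment_symm ℝ a b ▸ h.2⟩

theorem IsEdge.edgeDir {P : Set (ℝ × ℝ)} {v w : ℝ × ℝ} (h : IsEdge P v w) {u : ℤ × ℤ} {l : ℝ}
    (hl : 0 < l) (hw : w - v = l • intVec u) : EdgeDir P v u :=
  ⟨w, h, l, hl, hw⟩

/-- `P` lies in the cone with apex `v` spanned by the integer vectors `u₁` and `u₂`. -/
def SubsetCone (P : Set (ℝ × ℝ)) (v : ℝ × ℝ) (u₁ u₂ : ℤ × ℤ) : Prop :=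
  ∀ p ∈ P, ∃ s t : ℝ, 0 ≤ s ∧ 0 ≤ t ∧ p = v + (s • intVec u₁ + t • intVec u₂)

theorem smul_intVec_add_inj {u₁ u₂ : ℤ × ℤ} (hdet : u₁.1 * u₂.2 - u₁.2 * u₂.1 ≠ 0)
    {s t s' t' : ℝ}
    (h : s • intVec u₁ + t • intVec u₂ = s' • intVec u₁ + t' • intVec u₂) :
    s = s' ∧ t = t' := by
  have e₁ := congrArg Prod.fst h
  have e₂ := congrArg Prod.snd h
  simp only [intVec, Prod.fst_add, Prod.smul_fst, Prod.snd_add, Prod.smul_snd,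
    smul_eq_mul] at e₁ e₂
  have hd : (u₁.1 * u₂.2 - u₁.2 * u₂.1 : ℝ) ≠ 0 := by exact_mod_cast hdet
  constructor
  · apply mul_right_cancel₀ hd
    linear_combination (u₂.2 : ℝ) * e₁ - (u₂.1 : ℝ) * e₂
  · apply mul_right_cancel₀ hd
    linear_combination (u₁.1 : ℝ) * e₂ - (u₁.2 : ℝ) * e₁

/-- The apex of a cone containing `P` is an extreme point of `P`, if it belongs to `P`. -/
theorem SubsetCone.mem_extremePoints {P : Set (ℝ × ℝ)} {v : ℝ × ℝ} {u₁ u₂ : ℤ × ℤ}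
    (hcone : SubsetCone P v u₁ u₂) (hv : v ∈ P) (hdet : u₁.1 * u₂.2 - u₁.2 * u₂.1 ≠ 0) :
    v ∈ Set.extremePoints ℝ P := by
  refine ⟨hv, ?_⟩
  rintro x hx y hy ⟨r, r', hr, hr', hrr, h⟩
  obtain ⟨s, t, hs, ht, rfl⟩ := hcone x hx
  obtain ⟨s', t', hs', ht', rfl⟩ := hcone y hy
  have e : (r * s + r' * s') • intVec u₁ + (r * t + r' * t') • intVec u₂
      = (0 : ℝ) • intVec u₁ + (0 : ℝ) • intVec u₂ := by
    have : v = (r + r') • v := by rw [hrr, one_smul]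
    have h' := h.trans this
    rw [← sub_eq_zero] at h' ⊢
    rw [← h']
    module
  obtain ⟨e₁, e₂⟩ := smul_intVec_add_inj hdet e
  have a₁ := mul_nonneg hr'.le hs'
  have a₂ := mul_nonneg hr'.le ht'
  have hs0 : s = 0 := by nlinarith
  have ht0 : t = 0 := by nlinarith
  simp [hs0, ht0]

/-- In an extreme segment `[v, v + s u₁ + t u₂]` of a convex set which contains points on both
rays from `v` in the directions `u₁` and `u₂`, not both `s` and `t` are positive. -/
theorem IsEdge.coord_eq_zero {P : Set (ℝ × ℝ)} (hP : Convex ℝ P) {v : ℝ × ℝ} {u₁ u₂ : ℤ × ℤ}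
    (hdet : u₁.1 * u₂.2 - u₁.2 * u₂.1 ≠ 0) {l₁ l₂ : ℝ} (hl₁ : 0 < l₁) (hl₂ : 0 < l₂)
    (hv : v ∈ P) (h₁ : v + l₁ • intVec u₁ ∈ P) (h₂ : v + l₂ • intVec u₂ ∈ P)
    {s t : ℝ} (hs : 0 ≤ s) (ht : 0 ≤ t)
    (h : IsEdge P v (v + (s • intVec u₁ + t • intVec u₂))) : s = 0 ∨ t = 0 := by
  by_contra! hst
  have hs : 0 < s := lt_of_le_of_ne hs hst.1.symm
  have ht : 0 < t := lt_of_le_of_ne ht hst.2.symm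
  obtain ⟨d, hd, hd1, hd₁, hd₂⟩ : ∃ d : ℝ, 0 < d ∧ d ≤ 1 ∧ 2 * d * s ≤ l₁ ∧ 2 * d * t ≤ l₂ := by
    refine ⟨min 1 (min (l₁ / (2 * s)) (l₂ / (2 * t))), by positivity, min_le_left _ _, ?_, ?_⟩
    · have := (min_le_right 1 (min (l₁ / (2 * s)) (l₂ / (2 * t)))).trans (min_le_left _ _)
      rw [le_div_iff₀ (by positivity)] at this
      linarith
    · have := (min_le_right 1 (min (l₁ / (2 * s)) (l₂ / (2 * t)))).trans (min_le_right _ _)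
      rw [le_div_iff₀ (by positivity)] at this
      linarith
  have ray : ∀ {l m : ℝ} {u : ℤ × ℤ}, 0 < l → 0 ≤ m → m ≤ l → v + l • intVec u ∈ P →
      v + m • intVec u ∈ P := by
    intro l m u hl hm hml hu
    refine hP.segment_subset hv hu ⟨1 - m / l, m / l, ?_, by positivity, by ring, ?_⟩
    · rw [sub_nonneg, div_le_one hl]
      exact hml
    · have : m = m / l * l := by field_simp
      conv_rhs => rw [this]
      module
  have hmem : v + (2 * d * s) • intVec u₁ ∈ segment ℝ v (v + (s • intVec u₁ + t • intVec u₂)) := by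
    refine h.2.left_mem_of_mem_openSegment (ray hl₁ (by positivity) hd₁ h₁)
      (ray hl₂ (by positivity) hd₂ h₂)
      (z := v + d • (s • intVec u₁ + t • intVec u₂)) ?_ ?_
    · exact ⟨1 - d, d, by linarith, hd.le, by ring, by module⟩
    · exact ⟨1 / 2, 1 / 2, by norm_num, by norm_num, by norm_num, by module⟩
  obtain ⟨a, b, -, hb, hab, e⟩ := hmem
  have e' : (b * s) • intVec u₁ + (b * t) • intVec u₂
      = (2 * d * s) • intVec u₁ + (0 : ℝ) • intVec u₂ := by
    obtain rfl : a = 1 - b := by linarith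
    rw [← sub_eq_zero] at e ⊢
    rw [← e]
    module
  obtain ⟨e₁, e₂⟩ := smul_intVec_add_inj hdet e'
  have hb0 : b = 0 := by simpa [ht.ne'] using e₂
  rw [hb0, zero_mul] at e₁
  have : 0 < 2 * d * s := by positivity
  linarith

/-- A primitive integer vector on the ray spanned by a primitive integer vector equals it. -/
theorem eq_of_smul_intVec_eq {u u' : ℤ × ℤ} (hu : IsCoprime u.1 u.2) (hu' : IsCoprime u'.1 u'.2)
    {l m : ℝ} (hl : 0 < l) (hm : 0 ≤ m) (h : l • intVec u = m • intVec u') : u = u' := by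
  obtain ⟨x, y⟩ := u
  obtain ⟨x', y'⟩ := u'
  have e₁ := congrArg Prod.fst h
  have e₂ := congrArg Prod.snd h
  simp only [intVec, Prod.smul_fst, Prod.smul_snd, smul_eq_mul] at e₁ e₂ hu hu'
  obtain ⟨a, b, hab⟩ := hu'
  have hab' : (a * x' + b * y' : ℝ) = 1 := by exact_mod_cast hab
  set k : ℤ := a * x + b * y with hk
  have hkm : m = l * k := by
    push_cast [hk]
    linear_combination (-a : ℝ) * e₁ - b * e₂ - m * hab'
  have hx : x = k * x' := by
    have : (x : ℝ) = k * x' := by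
      apply mul_left_cancel₀ hl.ne'
      rw [e₁, hkm]
      ring
    exact_mod_cast this
  have hy : y = k * y' := by
    have : (y : ℝ) = k * y' := by
      apply mul_left_cancel₀ hl.ne'
      rw [e₂, hkm]
      ring
    exact_mod_cast this
  have hk0 : 0 ≤ k := by
    have : (0 : ℝ) ≤ k := by
      by_contra! hneg
      have := mul_neg_of_pos_of_neg hl hneg
      linarith
    exact_mod_cast this
  have hunit : IsUnit k := hu.isUnit_of_dvd' ⟨x', hx⟩ ⟨y', hy⟩
  have hk1 : k = 1 := by
    rcases Int.isUnit_iff.1 hunit with h | h <;> omega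
  rw [hx, hy, hk1, one_mul, one_mul]

/-- A convex set contained in a unimodular cone with apex `v`, both of whose rays carry an edge
of the set, satisfies the Delzant condition at `v`. -/
theorem SubsetCone.delzantAt {P : Set (ℝ × ℝ)} (hP : Convex ℝ P) {v : ℝ × ℝ} {u₁ u₂ : ℤ × ℤ}
    (hcone : SubsetCone P v u₁ u₂)
    (hdet : u₁.1 * u₂.2 - u₁.2 * u₂.1 = 1 ∨ u₁.1 * u₂.2 - u₁.2 * u₂.1 = -1)
    (h₁ : EdgeDir P v u₁) (h₂ : EdgeDir P v u₂) : DelzantAt P v u₁ u₂ := by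
  have c₁ : IsCoprime u₁.1 u₁.2 := by
    rcases hdet with h | h
    · exact ⟨u₂.2, -u₂.1, by linarith⟩
    · exact ⟨-u₂.2, u₂.1, by linarith⟩
  have c₂ : IsCoprime u₂.1 u₂.2 := by
    rcases hdet with h | h
    · exact ⟨-u₁.2, u₁.1, by linarith⟩
    · exact ⟨u₁.2, -u₁.1, by linarith⟩
  refine ⟨c₁, c₂, h₁, h₂, hdet, ?_⟩
  rintro u hu ⟨w, hw, l, hl, hlw⟩
  obtain ⟨w₁, hw₁, l₁, hl₁, e₁⟩ := h₁
  obtain ⟨w₂, hw₂, l₂, hl₂, e₂⟩ := h₂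
  obtain ⟨s, t, hs, ht, rfl⟩ := hcone w (hw.2.subset (right_mem_segment ℝ v w))
  rw [sub_eq_iff_eq_add'] at e₁ e₂
  have hst := hw.coord_eq_zero hP (by rcases hdet with h | h <;> rw [h] <;> decide) hl₁ hl₂
    (hw.2.subset (left_mem_segment ℝ v _))
    (e₁ ▸ hw₁.2.subset (right_mem_segment ℝ v w₁))
    (e₂ ▸ hw₂.2.subset (right_mem_segment ℝ v w₂)) hs ht
  rw [add_sub_cancel_left] at hlw
  rcases hst with rfl | rfl
  · right
    rw [zero_smul, zero_add] at hlw
    exact eq_of_smul_intVec_eq hu c₂ hl ht hlw.symm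
  · left
    rw [zero_smul, add_zero] at hlw
    exact eq_of_smul_intVec_eq hu c₁ hl hs hlw.symm

/-- A convex set that contains the vertices of a right isosceles triangle with legs of length
`c` along the coordinate axes has nonempty interior. -/
theorem nonempty_interior_of_triangle {P : Set (ℝ × ℝ)} (hP : Convex ℝ P) {c : ℝ} (hc : 0 < c)
    (h₀ : ((0, 0) : ℝ × ℝ) ∈ P) (h₁ : ((c, 0) : ℝ × ℝ) ∈ P) (h₂ : ((0, c) : ℝ × ℝ) ∈ P) :
    (interior P).Nonempty := by
  have hopen : IsOpen {p : ℝ × ℝ | 0 < p.1 ∧ 0 < p.2 ∧ p.1 + p.2 < c} :=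
    (isOpen_lt (by fun_prop) (by fun_prop)).and
      ((isOpen_lt (by fun_prop) (by fun_prop)).and (isOpen_lt (by fun_prop) (by fun_prop)))
  refine ⟨(c / 3, c / 3), interior_maximal ?_ hopen ⟨?_, ?_, ?_⟩⟩
  · rintro ⟨x, y⟩ ⟨hx, hy, hxy⟩
    dsimp only at hx hy hxy
    have hm : ((x + y, 0) : ℝ × ℝ) ∈ P := by
      refine hP.segment_subset h₀ h₁ ⟨1 - (x + y) / c, (x + y) / c, ?_, by positivity, by ring, ?_⟩
      · rw [sub_nonneg, div_le_one hc]
        exact hxy.le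
      · ext <;> simp [hc.ne']
    have hm' : ((0, x + y) : ℝ × ℝ) ∈ P := by
      refine hP.segment_subset h₀ h₂ ⟨1 - (x + y) / c, (x + y) / c, ?_, by positivity, by ring, ?_⟩
      · rw [sub_nonneg, div_le_one hc]
        exact hxy.le
      · ext <;> simp [hc.ne']
    have hne : x + y ≠ 0 := by positivity
    refine hP.segment_subset hm hm' ⟨x / (x + y), y / (x + y), by positivity, by positivity,
      by rw [← add_div, div_self hne], ?_⟩
    ext <;> simp [hne]
  all_goals dsimp only; linarith

/-- The five vertices of the pentagon obtained by chopping two corners of the standard triangle. -/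
def pentagonVertices (ε : ℝ) : Set (ℝ × ℝ) :=
  {(0, 0), (1 - ε, 0), (1 - ε, ε), (ε, 1 - ε), (0, 1 - ε)}

theorem pentagon_bounds {ε : ℝ} (h0 : 0 < ε) (h1 : ε < 1 / 2) {p : ℝ × ℝ} (hp : p ∈ convexHull ℝ (pentagonVertices ε)) :
    0 ≤ p.1 ∧ 0 ≤ p.2 ∧ p.1 ≤ 1 - ε ∧ p.2 ≤ 1 - ε ∧ p.1 + p.2 ≤ 1 := by
  have hconv : Convex ℝ {p : ℝ × ℝ | 0 ≤ p.1 ∧ 0 ≤ p.2 ∧ p.1 ≤ 1 - ε ∧ p.2 ≤ 1 - ε ∧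
      p.1 + p.2 ≤ 1} := by
    rintro ⟨x, y⟩ ⟨hx₁, hx₂, hx₃, hx₄, hx₅⟩ ⟨x', y'⟩ ⟨hy₁, hy₂, hy₃, hy₄, hy₅⟩ a b ha hb hab
    obtain rfl : a = 1 - b := by linarith
    dsimp only at hx₁ hx₂ hx₃ hx₄ hx₅ hy₁ hy₂ hy₃ hy₄ hy₅
    simp only [Set.mem_ofPred_eq, Prod.smul_mk, Prod.mk_add_mk, smul_eq_mul]
    refine ⟨by positivity, by positivity, ?_, ?_, ?_⟩ <;> nlinarith
  refine convexHull_min ?_ hconv hp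
  rintro q (rfl | rfl | rfl | rfl | rfl) <;>
    refine ⟨?_, ?_, ?_, ?_, ?_⟩ <;> dsimp only <;> linarith

theorem mem_segment_of_smul_eq {a b p : ℝ × ℝ} {s l : ℝ} (hs : 0 ≤ s) (hsl : s ≤ l) (hl : 0 < l)
    (h : l • p = (l - s) • a + s • b) : p ∈ segment ℝ a b := by
  refine ⟨(l - s) / l, s / l, div_nonneg (sub_nonneg.2 hsl) hl.le, by positivity, ?_, ?_⟩
  · rw [← add_div, sub_add_cancel, div_self hl.ne']
  · rw [div_eq_inv_mul, div_eq_inv_mul, mul_smul, mul_smul, ← smul_add, ← h, inv_smul_smul₀ hl.ne']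

theorem pentagon_isEdge_bottom {ε : ℝ} (h0 : 0 < ε) (h1 : ε < 1 / 2) :
    IsEdge (convexHull ℝ (pentagonVertices ε)) (0, 0) (1 - ε, 0) := by
  refine isEdge_of_support (convex_convexHull ℝ _) (fun h => ?_)
    (subset_convexHull ℝ _ (by simp [pentagonVertices]))
    (subset_convexHull ℝ _ (by simp [pentagonVertices])) 0 (-1) 0 (by ring) (by ring)
    (fun p hp => ?_) (fun p hp hpc => ?_)
  · rw [Prod.mk.injEq] at h
    linarith [h.1, h.2]
  · obtain ⟨b₁, b₂, b₃, b₄, b₅⟩ := pentagon_bounds h0 h1 hp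
    linarith
  · obtain ⟨b₁, b₂, b₃, b₄, b₅⟩ := pentagon_bounds h0 h1 hp
    exact mem_segment_of_smul_eq (s := p.1) (l := 1 - ε) (by linarith) (by linarith)
      (by linarith) (by ext <;>
        simp only [Prod.fst_add, Prod.smul_fst, Prod.snd_add, Prod.smul_snd, smul_eq_mul] <;>
        nlinarith)

theorem pentagon_isEdge_right {ε : ℝ} (h0 : 0 < ε) (h1 : ε < 1 / 2) :
    IsEdge (convexHull ℝ (pentagonVertices ε)) (1 - ε, 0) (1 - ε, ε) := by
  refine isEdge_of_support (convex_convexHull ℝ _) (fun h => ?_)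
    (subset_convexHull ℝ _ (by simp [pentagonVertices]))
    (subset_convexHull ℝ _ (by simp [pentagonVertices])) 1 0 (1 - ε) (by ring) (by ring)
    (fun p hp => ?_) (fun p hp hpc => ?_)
  · rw [Prod.mk.injEq] at h
    linarith [h.1, h.2]
  · obtain ⟨b₁, b₂, b₃, b₄, b₅⟩ := pentagon_bounds h0 h1 hp
    linarith
  · obtain ⟨b₁, b₂, b₃, b₄, b₅⟩ := pentagon_bounds h0 h1 hp
    exact mem_segment_of_smul_eq (s := p.2) (l := ε) (by linarith) (by linarith)
      (by linarith) (by ext <;>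
        simp only [Prod.fst_add, Prod.smul_fst, Prod.snd_add, Prod.smul_snd, smul_eq_mul] <;>
        nlinarith)

theorem pentagon_isEdge_diagonal {ε : ℝ} (h0 : 0 < ε) (h1 : ε < 1 / 2) :
    IsEdge (convexHull ℝ (pentagonVertices ε)) (1 - ε, ε) (ε, 1 - ε) := by
  refine isEdge_of_support (convex_convexHull ℝ _) (fun h => ?_)
    (subset_convexHull ℝ _ (by simp [pentagonVertices]))
    (subset_convexHull ℝ _ (by simp [pentagonVertices])) 1 1 1 (by ring) (by ring)
    (fun p hp => ?_) (fun p hp hpc => ?_)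
  · rw [Prod.mk.injEq] at h
    linarith [h.1, h.2]
  · obtain ⟨b₁, b₂, b₃, b₄, b₅⟩ := pentagon_bounds h0 h1 hp
    linarith
  · obtain ⟨b₁, b₂, b₃, b₄, b₅⟩ := pentagon_bounds h0 h1 hp
    exact mem_segment_of_smul_eq (s := p.2 - ε) (l := 1 - 2 * ε) (by linarith) (by linarith)
      (by linarith) (by ext <;>
        simp only [Prod.fst_add, Prod.smul_fst, Prod.snd_add, Prod.smul_snd, smul_eq_mul] <;>
        nlinarith)

theorem pentagon_isEdge_top {ε : ℝ} (h0 : 0 < ε) (h1 : ε < 1 / 2) :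
    IsEdge (convexHull ℝ (pentagonVertices ε)) (ε, 1 - ε) (0, 1 - ε) := by
  refine isEdge_of_support (convex_convexHull ℝ _) (fun h => ?_)
    (subset_convexHull ℝ _ (by simp [pentagonVertices]))
    (subset_convexHull ℝ _ (by simp [pentagonVertices])) 0 1 (1 - ε) (by ring) (by ring)
    (fun p hp => ?_) (fun p hp hpc => ?_)
  · rw [Prod.mk.injEq] at h
    linarith [h.1, h.2]
  · obtain ⟨b₁, b₂, b₃, b₄, b₅⟩ := pentagon_bounds h0 h1 hp
    linarith
  · obtain ⟨b₁, b₂, b₃, b₄, b₅⟩ := pentagon_bounds h0 h1 hp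
    exact mem_segment_of_smul_eq (s := ε - p.1) (l := ε) (by linarith) (by linarith)
      (by linarith) (by ext <;>
        simp only [Prod.fst_add, Prod.smul_fst, Prod.snd_add, Prod.smul_snd, smul_eq_mul] <;>
        nlinarith)

theorem pentagon_isEdge_left {ε : ℝ} (h0 : 0 < ε) (h1 : ε < 1 / 2) :
    IsEdge (convexHull ℝ (pentagonVertices ε)) (0, 1 - ε) (0, 0) := by
  refine isEdge_of_support (convex_convexHull ℝ _) (fun h => ?_)
    (subset_convexHull ℝ _ (by simp [pentagonVertices]))
    (subset_convexHull ℝ _ (by simp [pentagonVertices])) (-1) 0 0 (by ring) (by ring)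
    (fun p hp => ?_) (fun p hp hpc => ?_)
  · rw [Prod.mk.injEq] at h
    linarith [h.1, h.2]
  · obtain ⟨b₁, b₂, b₃, b₄, b₅⟩ := pentagon_bounds h0 h1 hp
    linarith
  · obtain ⟨b₁, b₂, b₃, b₄, b₅⟩ := pentagon_bounds h0 h1 hp
    exact mem_segment_of_smul_eq (s := 1 - ε - p.2) (l := 1 - ε) (by linarith) (by linarith)
      (by linarith) (by ext <;>
        simp only [Prod.fst_add, Prod.smul_fst, Prod.snd_add, Prod.smul_snd, smul_eq_mul] <;>
        nlinarith)

/-- At each of its five vertices the pentagon is contained in a unimodular cone whose two rays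
carry edges of the pentagon. -/
theorem pentagon_cone {ε : ℝ} (h0 : 0 < ε) (h1 : ε < 1 / 2) {v : ℝ × ℝ}
    (hv : v ∈ pentagonVertices ε) : ∃ u₁ u₂ : ℤ × ℤ,
      SubsetCone (convexHull ℝ (pentagonVertices ε)) v u₁ u₂ ∧
      (u₁.1 * u₂.2 - u₁.2 * u₂.1 = 1 ∨ u₁.1 * u₂.2 - u₁.2 * u₂.1 = -1) ∧
      EdgeDir (convexHull ℝ (pentagonVertices ε)) v u₁ ∧
      EdgeDir (convexHull ℝ (pentagonVertices ε)) v u₂ := by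
  have hpos : 0 < 1 - ε := by linarith
  have hpos' : 0 < 1 - 2 * ε := by linarith
  have bottom := pentagon_isEdge_bottom h0 h1
  have right := pentagon_isEdge_right h0 h1
  have diagonal := pentagon_isEdge_diagonal h0 h1
  have top := pentagon_isEdge_top h0 h1
  have left := pentagon_isEdge_left h0 h1
  rcases hv with rfl | rfl | rfl | rfl | rfl
  · refine ⟨(1, 0), (0, 1), fun p hp => ?_, by decide, bottom.edgeDir hpos ?_,
      left.symm.edgeDir hpos ?_⟩
    · obtain ⟨b₁, b₂, b₃, b₄, b₅⟩ := pentagon_bounds h0 h1 hp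
      exact ⟨p.1, p.2, by linarith, by linarith, by ext <;> simp [intVec]⟩
    all_goals ext <;> simp [intVec]
  · refine ⟨(-1, 0), (0, 1), fun p hp => ?_, by decide, bottom.symm.edgeDir hpos ?_,
      right.edgeDir h0 ?_⟩
    · obtain ⟨b₁, b₂, b₃, b₄, b₅⟩ := pentagon_bounds h0 h1 hp
      exact ⟨1 - ε - p.1, p.2, by linarith, by linarith, by ext <;> simp [intVec]⟩
    all_goals ext <;> simp [intVec]
  · refine ⟨(0, -1), (-1, 1), fun p hp => ?_, by decide, right.symm.edgeDir h0 ?_,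
      diagonal.edgeDir hpos' ?_⟩
    · obtain ⟨b₁, b₂, b₃, b₄, b₅⟩ := pentagon_bounds h0 h1 hp
      exact ⟨1 - p.1 - p.2, 1 - ε - p.1, by linarith, by linarith, by ext <;> simp [intVec] <;> ring⟩
    all_goals ext <;> simp [intVec] <;> ring
  · refine ⟨(1, -1), (-1, 0), fun p hp => ?_, by decide, diagonal.symm.edgeDir hpos' ?_,
      top.edgeDir h0 ?_⟩
    · obtain ⟨b₁, b₂, b₃, b₄, b₅⟩ := pentagon_bounds h0 h1 hp
      exact ⟨1 - ε - p.2, 1 - p.1 - p.2, by linarith, by linarith, by ext <;> simp [intVec]⟩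
    all_goals ext <;> simp [intVec] <;> ring
  · refine ⟨(1, 0), (0, -1), fun p hp => ?_, by decide, top.symm.edgeDir h0 ?_,
      left.edgeDir hpos ?_⟩
    · obtain ⟨b₁, b₂, b₃, b₄, b₅⟩ := pentagon_bounds h0 h1 hp
      exact ⟨p.1, 1 - ε - p.2, by linarith, by linarith, by ext <;> simp [intVec]⟩
    all_goals ext <;> simp [intVec]

theorem extremePoints_pentagon {ε : ℝ} (h0 : 0 < ε) (h1 : ε < 1 / 2) :
    Set.extremePoints ℝ (convexHull ℝ (pentagonVertices ε)) = pentagonVertices ε := by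
  refine extremePoints_convexHull_subset.antisymm fun v hv => ?_
  obtain ⟨u₁, u₂, hcone, hdet, -, -⟩ := pentagon_cone h0 h1 hv
  exact hcone.mem_extremePoints (subset_convexHull ℝ _ hv)
    (by rcases hdet with h | h <;> rw [h] <;> decide)

theorem isDelzantPolygon_pentagon {ε : ℝ} (h0 : 0 < ε) (h1 : ε < 1 / 2) :
    IsDelzantPolygon (pentagonVertices ε) := by
  refine ⟨Set.toFinite {(0, 0), (1 - ε, 0), (1 - ε, ε), (ε, 1 - ε), (0, 1 - ε)}, ?_,
    extremePoints_pentagon h0 h1, fun v hv => ?_⟩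
  · exact nonempty_interior_of_triangle (convex_convexHull ℝ _) (c := 1 - ε) (by linarith)
      (subset_convexHull ℝ _ (by simp [pentagonVertices]))
      (subset_convexHull ℝ _ (by simp [pentagonVertices]))
      (subset_convexHull ℝ _ (by simp [pentagonVertices]))
  · obtain ⟨u₁, u₂, hcone, hdet, e₁, e₂⟩ := pentagon_cone h0 h1 hv
    exact ⟨u₁, u₂, hcone.delzantAt (convex_convexHull ℝ _) hdet e₁ e₂⟩

/-- for `0 < ε < 1/2`, the pentagon
`P_ε = conv {(0,0), (1−ε,0), (1−ε,ε), (ε,1−ε), (0,1−ε)}` is a Delzant polygon with vertex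
set exactly these five points, and its five edges, taken in cyclic order, have rational
lengths `1−ε, ε, 1−2ε, ε, 1−ε` respectively. -/
theorem delzant_pentagon (ε : ℝ) (h0 : 0 < ε) (h1 : ε < 1 / 2) :
    IsDelzantPolygon
      ({(0, 0), (1 - ε, 0), (1 - ε, ε), (ε, 1 - ε), (0, 1 - ε)} : Set (ℝ × ℝ)) ∧
    Set.extremePoints ℝ (convexHull ℝ
        ({(0, 0), (1 - ε, 0), (1 - ε, ε), (ε, 1 - ε), (0, 1 - ε)} : Set (ℝ × ℝ)))
      = ({(0, 0), (1 - ε, 0), (1 - ε, ε), (ε, 1 - ε), (0, 1 - ε)} : Set (ℝ × ℝ)) ∧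
    IsEdge (convexHull ℝ
        ({(0, 0), (1 - ε, 0), (1 - ε, ε), (ε, 1 - ε), (0, 1 - ε)} : Set (ℝ × ℝ)))
        (0, 0) (1 - ε, 0) ∧
      RatLenIs ((1 - ε, (0 : ℝ)) - (0, 0)) (1 - ε) ∧
    IsEdge (convexHull ℝ
        ({(0, 0), (1 - ε, 0), (1 - ε, ε), (ε, 1 - ε), (0, 1 - ε)} : Set (ℝ × ℝ)))
        (1 - ε, 0) (1 - ε, ε) ∧
      RatLenIs ((1 - ε, ε) - ((1 : ℝ) - ε, (0 : ℝ))) ε ∧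
    IsEdge (convexHull ℝ
        ({(0, 0), (1 - ε, 0), (1 - ε, ε), (ε, 1 - ε), (0, 1 - ε)} : Set (ℝ × ℝ)))
        (1 - ε, ε) (ε, 1 - ε) ∧
      RatLenIs ((ε, 1 - ε) - ((1 : ℝ) - ε, ε)) (1 - 2 * ε) ∧
    IsEdge (convexHull ℝ
        ({(0, 0), (1 - ε, 0), (1 - ε, ε), (ε, 1 - ε), (0, 1 - ε)} : Set (ℝ × ℝ)))
        (ε, 1 - ε) (0, 1 - ε) ∧
      RatLenIs (((0 : ℝ), 1 - ε) - (ε, 1 - ε)) ε ∧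
    IsEdge (convexHull ℝ
        ({(0, 0), (1 - ε, 0), (1 - ε, ε), (ε, 1 - ε), (0, 1 - ε)} : Set (ℝ × ℝ)))
        (0, 1 - ε) (0, 0) ∧
      RatLenIs (((0 : ℝ), (0 : ℝ)) - (0, 1 - ε)) (1 - ε) := by
  refine ⟨isDelzantPolygon_pentagon h0 h1, extremePoints_pentagon h0 h1,
    pentagon_isEdge_bottom h0 h1, ⟨by linarith, (1, 0), isCoprime_one_left, ?_⟩,
    pentagon_isEdge_right h0 h1, ⟨h0, (0, 1), isCoprime_one_right, ?_⟩,
    pentagon_isEdge_diagonal h0 h1, ⟨by linarith, (-1, 1), isCoprime_one_right, ?_⟩,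
    pentagon_isEdge_top h0 h1, ⟨h0, (-1, 0), isCoprime_one_left.neg_left, ?_⟩,
    pentagon_isEdge_left h0 h1, ⟨by linarith, (0, -1), isCoprime_one_right.neg_right, ?_⟩⟩
  all_goals ext <;> simp [intVec] <;> ring
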